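/- Let α be an infinite type with decidable equality and let t, u be first-order terms over a language L with variables in α. Any two most general unifiers of t and u are equal up to renaming: if θ and θ' are both MGUs of t and u, then there exists a bijection e : α ≃ α such that θ' x = (θ x).relabel e for every variable x in t.varFinset ∪ u.varFinset. -/

import Mathlib

open FirstOrder

namespace FirstOrder.Language.Term

variable {L : Language} {α β γ : Type*}

theorem subst_subst (t : L.Term α) (f : α → L.Term β) (g : β → L.Term γ) :
    (t.subst f).subst g = t.subst fun a => (f a).subst g := by
  induction t with
  | var => rfl
  | func _ _ ih => simp [ih]

/-- A substitution that fixes a term fixes each of its variables. -/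
theorem eq_var_of_subst_eq_self [DecidableEq α] {t : L.Term α} {f : α → L.Term α}
    (h : t.subst f = t) : ∀ a ∈ t.varFinset, f a = var a := by
  induction t with
  | var => simpa using h
  | func F ts ih =>
    simp only [subst, func.injEq, heq_eq_eq, true_and] at h
    simp only [varFinset, Finset.mem_biUnion, Finset.mem_univ, true_and, forall_exists_index]
    exact fun a i => ih i (congrFun h i) a

theorem subst_eq_relabel [DecidableEq α] {t : L.Term α} {f : α → L.Term β} {g : α → β}
    (h : ∀ a ∈ t.varFinset, f a = var (g a)) : t.subst f = t.relabel g := by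
  induction t with
  | var => simpa using h
  | func F ts ih =>
    simp only [subst, relabel, func.injEq, heq_eq_eq, true_and]
    funext i
    exact ih i fun a ha => h a (Finset.mem_biUnion.2 ⟨i, Finset.mem_univ i, ha⟩)

theorem exists_eq_var_of_subst_eq_var {t : L.Term α} {f : α → L.Term β} {b : β}
    (h : t.subst f = var b) : ∃ a, t = var a := by
  cases t with
  | var a => exact ⟨a, rfl⟩
  | func => simp at h

/-- A substitution with a left inverse on a finite set of variables agrees there with a
permutation of the variables. -/
theorem exists_perm_of_subst_eq_var (s : Finset α) {f g : α → L.Term α}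
    (h : ∀ a ∈ s, (f a).subst g = var a) : ∃ e : α ≃ α, ∀ a ∈ s, f a = var (e a) := by
  choose k hk using fun a : s => exists_eq_var_of_subst_eq_var (h a a.2)
  have hinj : Function.Injective k := fun a b hab => by
    have hb := h b b.2
    rw [hk b, ← hab, ← hk a, h a a.2] at hb
    exact Subtype.ext (var.inj hb)
  obtain ⟨e, he⟩ := Equiv.Perm.exists_extending_pair _ k Subtype.val_injective hinj
  exact ⟨e, fun a ha => (hk ⟨a, ha⟩).trans (congrArg var (he ⟨a, ha⟩).symm)⟩

end FirstOrder.Language.Term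

theorem mgu_unique_up_to_renaming {L : FirstOrder.Language} {α : Type*}
    [Infinite α] [DecidableEq α] (t u : L.Term α) (θ θ' : α → L.Term α)
    (hθ_unif : t.subst θ = u.subst θ)
    (hθ_mgu : ∀ ψ : α → L.Term α, t.subst ψ = u.subst ψ →
        ∃ σ : α → L.Term α, ∀ x : α, ψ x = (θ x).subst σ)
    (hθ'_unif : t.subst θ' = u.subst θ')
    (hθ'_mgu : ∀ ψ : α → L.Term α, t.subst ψ = u.subst ψ →
        ∃ σ : α → L.Term α, ∀ x : α, ψ x = (θ' x).subst σ) :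
    ∃ e : α ≃ α, ∀ x ∈ t.varFinset ∪ u.varFinset, θ' x = (θ x).relabel e := by
  obtain ⟨σ, hσ⟩ := hθ_mgu θ' hθ'_unif
  obtain ⟨σ', hσ'⟩ := hθ'_mgu θ hθ_unif
  obtain ⟨e, he⟩ := Language.Term.exists_perm_of_subst_eq_var
    ((t.varFinset ∪ u.varFinset).biUnion fun x => (θ x).varFinset) (f := σ) (g := σ') (by
      intro a ha
      obtain ⟨x, -, hx⟩ := Finset.mem_biUnion.1 ha
      refine Language.Term.eq_var_of_subst_eq_self (f := fun a => (σ a).subst σ') ?_ a hx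
      rw [← Language.Term.subst_subst, ← hσ, ← hσ'])
  refine ⟨e, fun x hx => ?_⟩
  rw [hσ]
  exact Language.Term.subst_eq_relabel fun a ha => he a (Finset.mem_biUnion.2 ⟨x, hx, ha⟩)
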